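/- Let (L,(·,·),Φ) be a p.n. root lattice of rank n with Weyl group W, let w ∈ W and let (α_1,…,α_{l(w)}) be a reduced presentation of w. Then the ℚ-span of α_1,…,α_{l(w)} in L_ℚ := L ⊗ ℚ equals the orthogonal complement with respect to (·,·) of the fixed space ker(w − id : L_ℚ → L_ℚ); in particular l(w) = n − dim_ℚ ker(w − id : L_ℚ → L_ℚ). -/

import Mathlib

open Submodule

/-- A (possibly nonreduced) root lattice, modeled inside the ℚ-vector space `V = L ⊗ ℚ`
(the lattice itself is `L = span ℤ Φ`, a free ℤ-module of rank `dim V ≥ 1`). -/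
structure IsPNRootLattice {V : Type} [AddCommGroup V] [Module ℚ V]
    (B : V →ₗ[ℚ] V →ₗ[ℚ] ℚ) (Φ : Set V) : Prop where
  finite : Φ.Finite
  nonempty : Φ.Nonempty
  ne_zero : ∀ α ∈ Φ, α ≠ 0
  symm : ∀ x y : V, B x y = B y x
  posdef : ∀ x : V, x ≠ 0 → 0 < B x x
  pair_int : ∀ α ∈ Φ, ∀ β ∈ Φ, ∃ c : ℤ, 2 * B β α = (c : ℚ) * B α α
  refl_maps : ∀ α ∈ Φ, (fun x => x - (2 * B x α / B α α) • α) '' Φ = Φ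
  span_rat : span ℚ Φ = ⊤

/-- The reflection `s_α : x ↦ x - (2 (x,α) / (α,α)) • α`, as a ℚ-linear endomorphism. -/
noncomputable def reflV {V : Type} [AddCommGroup V] [Module ℚ V]
    (B : V →ₗ[ℚ] V →ₗ[ℚ] ℚ) (α : V) : Module.End ℚ V :=
  LinearMap.id - ((2 / B α α) • (B.flip α)).smulRight α

/-- `(α_1, …, α_k)` is a presentation of `w`: all `α_i` are roots and
`w = s_{α_1} ∘ ⋯ ∘ s_{α_k}`. -/
def IsPres {V : Type} [AddCommGroup V] [Module ℚ V]
    (B : V →ₗ[ℚ] V →ₗ[ℚ] ℚ) (Φ : Set V) (w : Module.End ℚ V) (l : List V) : Prop :=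
  (∀ α ∈ l, α ∈ Φ) ∧ (l.map (reflV B)).prod = w

/-- The length `l(w)`: the minimal length of a presentation of `w`. -/
noncomputable def len {V : Type} [AddCommGroup V] [Module ℚ V]
    (B : V →ₗ[ℚ] V →ₗ[ℚ] ℚ) (Φ : Set V) (w : Module.End ℚ V) : ℕ :=
  sInf {k | ∃ l : List V, IsPres B Φ w l ∧ l.length = k}

section helpers

variable {V : Type} [AddCommGroup V] [Module ℚ V] {B : V →ₗ[ℚ] V →ₗ[ℚ] ℚ} {Φ : Set V}

lemma reflV_apply (B : V →ₗ[ℚ] V →ₗ[ℚ] ℚ) (α x : V) :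
    reflV B α x = x - (2 * B x α / B α α) • α := by
  simp only [reflV, LinearMap.sub_apply, LinearMap.id_apply, LinearMap.smulRight_apply,
    LinearMap.smul_apply, LinearMap.flip_apply, smul_eq_mul]
  congr 2
  ring

lemma IsPNRootLattice.pos (h : IsPNRootLattice B Φ) {α : V} (hα : α ∈ Φ) : 0 < B α α :=
  h.posdef α (h.ne_zero α hα)

lemma IsPNRootLattice.refl_mem (h : IsPNRootLattice B Φ) {α β : V} (hα : α ∈ Φ) (hβ : β ∈ Φ) :
    reflV B α β ∈ Φ := by
  rw [reflV_apply, ← h.refl_maps α hα]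
  exact ⟨β, hβ, rfl⟩

lemma reflV_self {α : V} (hα : B α α ≠ 0) : reflV B α α = -α := by
  rw [reflV_apply, mul_div_assoc, div_self hα, mul_one, two_smul]
  abel

lemma IsPNRootLattice.neg_mem (h : IsPNRootLattice B Φ) {α : V} (hα : α ∈ Φ) : -α ∈ Φ := by
  rw [← reflV_self (h.pos hα).ne']
  exact h.refl_mem hα hα

lemma reflV_smul {α : V} {t : ℚ} (ht : t ≠ 0) : reflV B (t • α) = reflV B α := by
  ext x
  rw [reflV_apply, reflV_apply, smul_smul]
  congr 2
  simp only [map_smul, LinearMap.smul_apply, smul_eq_mul]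
  by_cases h0 : B α α = 0
  · simp [h0]
  · field_simp

lemma reflV_neg {α : V} : reflV B (-α) = reflV B α := by
  have := reflV_smul (B := B) (α := α) (t := -1) (by norm_num)
  simpa using this

lemma reflV_mul_self {α : V} (hα : B α α ≠ 0) : reflV B α * reflV B α = 1 := by
  ext x
  simp only [Module.End.mul_apply, Module.End.one_apply]
  rw [reflV_apply B α x, map_sub, map_smul, reflV_self hα, reflV_apply]
  module

lemma IsPNRootLattice.isom (h : IsPNRootLattice B Φ) {α : V} (hα : B α α ≠ 0) (x y : V) :
    B (reflV B α x) (reflV B α y) = B x y := by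
  rw [reflV_apply, reflV_apply]
  simp only [map_sub, map_smul, LinearMap.sub_apply, LinearMap.smul_apply, smul_eq_mul,
    h.symm α y]
  field_simp
  ring

lemma IsPNRootLattice.adj (h : IsPNRootLattice B Φ) {α : V} (hα : B α α ≠ 0) (x y : V) :
    B (reflV B α x) y = B x (reflV B α y) := by
  rw [← h.isom hα x, ← Module.End.mul_apply, reflV_mul_self hα, Module.End.one_apply]

lemma IsPNRootLattice.conj (h : IsPNRootLattice B Φ) {α : V} (hα : B α α ≠ 0) (β : V) :
    reflV B α * reflV B (reflV B α β) = reflV B β * reflV B α := by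
  ext x
  simp only [Module.End.mul_apply]
  rw [reflV_apply B (reflV B α β) x, reflV_apply B β, map_sub, map_smul, h.isom hα, ← h.adj hα,
    ← Module.End.mul_apply (reflV B α), reflV_mul_self hα, Module.End.one_apply]

lemma IsPNRootLattice.sub_mem (h : IsPNRootLattice B Φ) {α β : V} (hα : α ∈ Φ) (hβ : β ∈ Φ)
    (hp : 0 < B β α) (hn : ¬ ∃ t : ℚ, β = t • α) : β - α ∈ Φ := by
  have ha := h.pos hα
  have hb := h.pos hβ
  obtain ⟨p, hp'⟩ := h.pair_int α hα β hβ
  obtain ⟨q, hq'⟩ := h.pair_int β hβ α hα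
  have hs := h.symm α β
  rw [hs] at hq'
  have hcs : B β α * B β α < B α α * B β β := by
    have hz : β - (B β α / B α α) • α ≠ 0 := fun h0 => hn ⟨_, sub_eq_zero.mp h0⟩
    have := h.posdef _ hz
    simp only [map_sub, map_smul, LinearMap.sub_apply, LinearMap.smul_apply, smul_eq_mul, hs] at this
    have h2 := mul_pos ha this
    field_simp at h2
    nlinarith
  have hp0 : 0 < p := by
    have : (0:ℚ) < p := by
      by_contra hc
      nlinarith
    exact_mod_cast this
  have hq0 : 0 < q := by
    have : (0:ℚ) < q := by
      by_contra hc
      nlinarith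
    exact_mod_cast this
  have hpq : p * q < 4 := by
    have : ((p:ℚ) * q) < 4 := by
      have e : ((p:ℚ) * q) * (B α α * B β β) = 4 * (B β α * B β α) := by
        linear_combination (-2 * B β α) * hp' - p * B α α * hq'
      by_contra hc
      push Not at hc
      have := mul_le_mul_of_nonneg_right hc (mul_pos ha hb).le
      linarith
    exact_mod_cast this
  have : p = 1 ∨ q = 1 := by
    by_contra hc
    push Not at hc
    have h1 : 2 ≤ p := by omega
    have h2 : 2 ≤ q := by omega
    nlinarith
  rcases this with rfl | rfl
  · have := h.refl_mem hα hβ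
    rw [reflV_apply, hp'] at this
    simpa [ha.ne'] using this
  · have := h.neg_mem (h.refl_mem hβ hα)
    rw [reflV_apply, hs, hq'] at this
    simpa [hb.ne'] using this

/-- indecomposable positive root -/
def IsSimp (B : V →ₗ[ℚ] V →ₗ[ℚ] ℚ) (Φ : Set V) (v α : V) : Prop :=
  α ∈ Φ ∧ 0 < B v α ∧
    ∀ β ∈ Φ, ∀ γ ∈ Φ, 0 < B v β → 0 < B v γ → α ≠ β + γ

variable {v : V}

lemma IsPNRootLattice.no_sum (h : IsPNRootLattice B Φ) (hv : ∀ α ∈ Φ, B v α ≠ 0) {α : V}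
    (hα : IsSimp B Φ v α) (c : ℕ) : ∀ β ∈ Φ, ∀ γ ∈ Φ, 0 < B v β → 0 < B v γ →
    (¬ ∃ t : ℚ, β = t • α) → β + γ ≠ (c : ℚ) • α := by
  induction c with
  | zero =>
    intro β hβ γ hγ pβ pγ hn he
    have := congrArg (B v) he
    simp at this
    linarith
  | succ c ih =>
    intro β hβ γ hγ pβ pγ hn he
    have key : ∀ β ∈ Φ, 0 < B v β → (¬ ∃ t : ℚ, β = t • α) → 0 < B β α →
        β - α ∈ Φ ∧ 0 < B v (β - α) := by
      intro β hβ pβ hn hp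
      have hm := h.sub_mem hα.1 hβ hp hn
      refine ⟨hm, ?_⟩
      by_contra hc
      have hne := hv _ hm
      have hneg : 0 < B v (-(β - α)) := by
        rw [map_neg]
        rcases lt_or_gt_of_ne hne with h1 | h1
        · linarith
        · exact absurd h1 hc
      exact hα.2.2 β hβ _ (h.neg_mem hm) pβ hneg (by abel)
    have hn' : ¬ ∃ t : ℚ, γ = t • α := by
      rintro ⟨t, rfl⟩
      exact hn ⟨((c + 1 : ℕ) : ℚ) - t, by rw [sub_smul, ← he]; abel⟩
    have hsum : 0 < B β α + B γ α := by
      have := congrArg (fun x => B x α) he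
      simp only [map_add, LinearMap.add_apply, map_smul, LinearMap.smul_apply, smul_eq_mul] at this
      rw [this]
      exact mul_pos (by positivity) (h.pos hα.1)
    push_cast at he
    rw [add_smul, one_smul] at he
    rcases lt_or_ge 0 (B β α) with h1 | h1
    · obtain ⟨hm, hp⟩ := key β hβ pβ hn h1
      refine ih _ hm γ hγ hp pγ ?_ (by rw [sub_add_eq_add_sub, he]; abel)
      rintro ⟨t, ht⟩
      exact hn ⟨t + 1, by rw [add_smul, one_smul, ← ht]; abel⟩
    · obtain ⟨hm, hp⟩ := key γ hγ pγ hn' (by linarith)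
      exact ih _ hβ _ hm pβ hp hn (by rw [← add_sub_assoc, he]; abel)

lemma IsPNRootLattice.simp_pos (h : IsPNRootLattice B Φ) (hv : ∀ α ∈ Φ, B v α ≠ 0) {α : V}
    (hα : IsSimp B Φ v α) {β : V} (hβ : β ∈ Φ) (pβ : 0 < B v β) (hn : ¬ ∃ t : ℚ, β = t • α) :
    0 < B v (reflV B α β) := by
  by_contra hc
  have hm := h.refl_mem hα.1 hβ
  have hneg : 0 < B v (-(reflV B α β)) := by
    rw [map_neg]
    rcases lt_or_gt_of_ne (hv _ hm) with h1 | h1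
    · linarith
    · exact absurd h1 hc
  obtain ⟨c, hc'⟩ := h.pair_int α hα.1 β hβ
  have ha := (h.pos hα.1).ne'
  have hs : β + -(reflV B α β) = (c : ℚ) • α := by
    rw [reflV_apply, hc', mul_div_assoc, div_self ha, mul_one]
    abel
  have hc0 : 0 ≤ c := by
    have := congrArg (B v) hs
    simp only [map_add, map_smul, smul_eq_mul] at this
    have h2 : (0:ℚ) < c * B v α := by linarith
    have := (pos_iff_pos_of_mul_pos h2).2 hα.2.1
    exact_mod_cast this.le
  obtain ⟨k, rfl⟩ := Int.eq_ofNat_of_zero_le hc0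
  exact h.no_sum hv hα k β hβ _ (h.neg_mem hm) pβ hneg hn (by simpa using hs)

lemma IsPNRootLattice.height_ind (h : IsPNRootLattice B Φ) (P : V → Prop)
    (hP : ∀ β ∈ Φ, 0 < B v β → (∀ γ ∈ Φ, 0 < B v γ → B v γ < B v β → P γ) → P β) :
    ∀ β ∈ Φ, 0 < B v β → P β := by
  by_contra hc
  push Not at hc
  obtain ⟨β, hβ, pβ, nβ⟩ := hc
  obtain ⟨m, hm⟩ := Set.Finite.exists_minimalFor (fun x => B v x)
    {β | β ∈ Φ ∧ 0 < B v β ∧ ¬ P β} (h.finite.subset fun x hx => hx.1) ⟨β, hβ, pβ, nβ⟩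
  refine hm.1.2.2 (hP m hm.1.1 hm.1.2.1 fun γ hγ pγ hlt => ?_)
  by_contra hn
  have := hm.2 (j := γ) ⟨hγ, pγ, hn⟩ hlt.le
  exact absurd hlt (not_lt.mpr this)

lemma IsPNRootLattice.exists_simp (h : IsPNRootLattice B Φ) {β : V}
    (hβ : β ∈ Φ) (pβ : 0 < B v β) : ∃ α, IsSimp B Φ v α ∧ 0 < B β α := by
  by_contra hc
  push Not at hc
  have : ∀ γ ∈ Φ, 0 < B v γ → B β γ ≤ 0 := by
    apply h.height_ind
    intro γ hγ pγ ih
    by_cases hs : IsSimp B Φ v γ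
    · exact hc γ hs
    · simp only [IsSimp, hγ, pγ, true_and] at hs
      push Not at hs
      obtain ⟨a, ha, b, hb, pa, pb, rfl⟩ := hs
      have h1 := ih a ha pa (by rw [map_add]; linarith)
      have h2 := ih b hb pb (by rw [map_add]; linarith)
      rw [map_add]; linarith
  exact absurd (h.pos hβ) (not_lt.mpr (this β hβ pβ))

lemma ne_zero_of_root (h : IsPNRootLattice B Φ) {β α : V} {t : ℚ} (hβ : β ∈ Φ)
    (e : β = t • α) : t ≠ 0 := by
  rintro rfl
  exact h.ne_zero β hβ (by simpa using e)

lemma IsPNRootLattice.gen_pos (h : IsPNRootLattice B Φ) (hv : ∀ α ∈ Φ, B v α ≠ 0) :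
    ∀ β ∈ Φ, 0 < B v β → ∃ l : List V, (∀ a ∈ l, IsSimp B Φ v a) ∧
      (l.map (reflV B)).prod = reflV B β := by
  apply h.height_ind
  intro β hβ pβ ih
  obtain ⟨α, hα, hp⟩ := h.exists_simp hβ pβ
  have ha := h.pos hα.1
  by_cases hn : ∃ t : ℚ, β = t • α
  · obtain ⟨t, rfl⟩ := hn
    refine ⟨[α], by simpa using hα, ?_⟩
    simp [reflV_smul (ne_zero_of_root h hβ rfl)]
  · obtain ⟨l, hl, hl'⟩ := ih _ (h.refl_mem hα.1 hβ) (h.simp_pos hv hα hβ pβ hn) (by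
      rw [reflV_apply, map_sub, map_smul, smul_eq_mul]
      have : 0 < 2 * B β α / B α α * B v α := mul_pos (by positivity) hα.2.1
      linarith)
    refine ⟨α :: (l ++ [α]), ?_, ?_⟩
    · intro a ha
      simp at ha
      rcases ha with rfl | ha | rfl
      · exact hα
      · exact hl a ha
      · exact hα
    · simp only [List.map_cons, List.map_append, List.prod_cons, List.prod_append, List.map_nil,
        List.prod_nil, mul_one, hl']
      rw [← mul_assoc, h.conj ha.ne', mul_assoc, reflV_mul_self ha.ne', mul_one]

lemma IsPNRootLattice.gen (h : IsPNRootLattice B Φ) (hv : ∀ α ∈ Φ, B v α ≠ 0)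
    (l : List V) (hl : ∀ a ∈ l, a ∈ Φ) : ∃ l' : List V, (∀ a ∈ l', IsSimp B Φ v a) ∧
      (l'.map (reflV B)).prod = (l.map (reflV B)).prod := by
  induction l with
  | nil => exact ⟨[], by simp, rfl⟩
  | cons a l ih =>
    obtain ⟨l1, h1, h1'⟩ := ih fun b hb => hl b (by simp [hb])
    have ha := hl a (by simp)
    have : ∃ l : List V, (∀ a ∈ l, IsSimp B Φ v a) ∧ (l.map (reflV B)).prod = reflV B a := by
      rcases lt_or_gt_of_ne (hv a ha) with h2 | h2
      · rw [← reflV_neg]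
        exact h.gen_pos hv _ (h.neg_mem ha) (by rw [map_neg]; linarith)
      · exact h.gen_pos hv a ha h2
    obtain ⟨l2, h2, h2'⟩ := this
    refine ⟨l2 ++ l1, ?_, by simp [h1', h2']⟩
    intro b hb
    rcases List.mem_append.mp hb with hb | hb
    · exact h2 b hb
    · exact h1 b hb

lemma IsPNRootLattice.exch (h : IsPNRootLattice B Φ) (hv : ∀ α ∈ Φ, B v α ≠ 0)
    (l : List V) (hl : ∀ a ∈ l, IsSimp B Φ v a) : ∀ α ∈ Φ, 0 < B v α →
    B ((l.map (reflV B)).prod v) α < 0 → ∃ l' : List V, (∀ a ∈ l', IsSimp B Φ v a) ∧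
      l'.length + 1 = l.length ∧ (l'.map (reflV B)).prod = reflV B α * (l.map (reflV B)).prod := by
  induction l with
  | nil =>
    intro α hα pα hneg
    simp at hneg
    linarith
  | cons g l ih =>
    intro α hα pα hneg
    have hg := hl g (by simp)
    have hl2 : ∀ a ∈ l, IsSimp B Φ v a := fun a ha => hl a (by simp [ha])
    have g0 := (h.pos hg.1).ne'
    by_cases hn : ∃ t : ℚ, α = t • g
    · obtain ⟨t, rfl⟩ := hn
      refine ⟨l, hl2, rfl, ?_⟩
      rw [reflV_smul (ne_zero_of_root h hα rfl), List.map_cons, List.prod_cons, ← mul_assoc,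
        reflV_mul_self g0, one_mul]
    · rw [List.map_cons, List.prod_cons, Module.End.mul_apply, h.adj g0] at hneg
      obtain ⟨l', h1, h2, h3⟩ := ih hl2 _ (h.refl_mem hg.1 hα) (h.simp_pos hv hg hα pα hn) hneg
      refine ⟨g :: l', ?_, by simp [h2], ?_⟩
      · intro a ha
        rcases List.mem_cons.mp ha with rfl | ha
        · exact hg
        · exact h1 a ha
      · rw [List.map_cons, List.prod_cons, h3, ← mul_assoc, h.conj g0, List.map_cons,
          List.prod_cons, mul_assoc]

lemma IsPNRootLattice.free_simp (h : IsPNRootLattice B Φ) (hv : ∀ α ∈ Φ, B v α ≠ 0) (k : ℕ) :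
    ∀ l : List V, l.length ≤ k → (∀ a ∈ l, IsSimp B Φ v a) → (l.map (reflV B)).prod v = v →
    (l.map (reflV B)).prod = 1 := by
  induction k with
  | zero =>
    intro l hk _ _
    have : l = [] := by simpa using hk
    simp [this]
  | succ k ih =>
    intro l hk hl hfix
    cases l with
    | nil => simp
    | cons a l =>
      have ha := hl a (by simp)
      have a0 := (h.pos ha.1).ne'
      rw [List.map_cons, List.prod_cons] at hfix ⊢
      have h1 : (l.map (reflV B)).prod v = reflV B a v := by
        rw [← hfix, ← Module.End.mul_apply (reflV B a), ← mul_assoc, reflV_mul_self a0, one_mul,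
          hfix]
      obtain ⟨l', h2, h3, h4⟩ := h.exch hv l (fun b hb => hl b (by simp [hb])) a ha.1 ha.2.1 (by
        rw [h1, h.adj a0, reflV_self a0, map_neg]
        linarith [ha.2.1])
      rw [← h4]
      refine ih l' ?_ h2 (by rw [h4, hfix])
      simp at hk
      omega

lemma IsPNRootLattice.free (h : IsPNRootLattice B Φ) (hv : ∀ α ∈ Φ, B v α ≠ 0)
    (l : List V) (hl : ∀ a ∈ l, a ∈ Φ) (hfix : (l.map (reflV B)).prod v = v) :
    (l.map (reflV B)).prod = 1 := by
  obtain ⟨l', h1, h2⟩ := h.gen hv l hl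
  rw [← h2] at hfix ⊢
  exact h.free_simp hv _ l' le_rfl h1 hfix

lemma IsPNRootLattice.prod_isom (h : IsPNRootLattice B Φ) (l : List V) (hl : ∀ a ∈ l, a ∈ Φ)
    (x y : V) : B ((l.map (reflV B)).prod x) ((l.map (reflV B)).prod y) = B x y := by
  induction l with
  | nil => simp
  | cons a l ih =>
    rw [List.map_cons, List.prod_cons, Module.End.mul_apply, Module.End.mul_apply,
      h.isom (h.pos (hl a (by simp))).ne', ih fun b hb => hl b (by simp [hb])]

lemma IsPNRootLattice.exists_root (h : IsPNRootLattice B Φ) (l : List V) (hl : ∀ a ∈ l, a ∈ Φ)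
    (hne : (l.map (reflV B)).prod ≠ 1) :
    ∃ α ∈ Φ, ∀ x, (l.map (reflV B)).prod x = x → B x α = 0 := by
  by_contra hc
  push Not at hc
  have : Finite Φ := h.finite
  obtain ⟨v, hv, hv'⟩ := Module.Dual.exists_forall_mem_ne_zero_of_forall_exists
    (LinearMap.ker ((l.map (reflV B)).prod - 1)) (fun a : Φ => B.flip a.1) (by
      rintro ⟨a, ha⟩
      obtain ⟨x, hx, hx'⟩ := hc a ha
      exact ⟨x, by simp [LinearMap.mem_ker, hx], by simpa using hx'⟩)
  refine hne (h.free (v := v) (fun α hα => by simpa using hv' ⟨α, hα⟩) l hl ?_)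
  rw [LinearMap.mem_ker] at hv
  exact sub_eq_zero.mp (by simpa using hv)

variable [FiniteDimensional ℚ V]

lemma IsPNRootLattice.nondeg (h : IsPNRootLattice B Φ) :
    LinearMap.BilinForm.Nondegenerate B := by
  constructor
  · intro x hx
    by_contra h0
    exact (h.posdef x h0).ne' (hx x)
  · intro x hx
    by_contra h0
    exact (h.posdef x h0).ne' (hx x)

lemma IsPNRootLattice.isRefl (h : IsPNRootLattice B Φ) : LinearMap.IsRefl B := by
  intro x y hxy
  rw [h.symm, hxy]

lemma IsPNRootLattice.range_eq (h : IsPNRootLattice B Φ) (l : List V) (hl : ∀ a ∈ l, a ∈ Φ) :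
    LinearMap.range ((l.map (reflV B)).prod - 1) =
      LinearMap.BilinForm.orthogonal B (LinearMap.ker ((l.map (reflV B)).prod - 1)) := by
  apply Submodule.eq_of_le_of_finrank_eq
  · rintro _ ⟨x, rfl⟩
    rw [LinearMap.BilinForm.mem_orthogonal_iff]
    intro y hy
    rw [LinearMap.mem_ker, LinearMap.sub_apply, sub_eq_zero, Module.End.one_apply] at hy
    change B y _ = 0
    rw [LinearMap.sub_apply, map_sub, Module.End.one_apply]
    nth_rw 1 [← hy]
    rw [h.prod_isom l hl, sub_self]
  · rw [LinearMap.BilinForm.finrank_orthogonal h.nondeg]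
    have := LinearMap.finrank_range_add_finrank_ker ((l.map (reflV B)).prod - 1)
    omega

lemma IsPNRootLattice.upper (h : IsPNRootLattice B Φ) (k : ℕ) : ∀ l : List V, (∀ a ∈ l, a ∈ Φ) →
    Module.finrank ℚ V ≤ k + Module.finrank ℚ (LinearMap.ker ((l.map (reflV B)).prod - 1)) →
    ∃ l' : List V, (∀ a ∈ l', a ∈ Φ) ∧ (l'.map (reflV B)).prod = (l.map (reflV B)).prod ∧
      l'.length ≤ k := by
  induction k with
  | zero =>
    intro l hl hk
    refine ⟨[], by simp, ?_, by simp⟩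
    have : LinearMap.ker ((l.map (reflV B)).prod - 1) = ⊤ := by
      apply Submodule.eq_top_of_finrank_eq
      have := Submodule.finrank_le (LinearMap.ker ((l.map (reflV B)).prod - 1))
      omega
    rw [LinearMap.ker_eq_top, sub_eq_zero] at this
    rw [this]; rfl
  | succ k ih =>
    intro l hl hk
    by_cases hne : (l.map (reflV B)).prod = 1
    · exact ⟨[], by simp, by rw [hne]; rfl, by simp⟩
    obtain ⟨α, hα, hα'⟩ := h.exists_root l hl hne
    have a0 := (h.pos hα).ne'
    set w := (l.map (reflV B)).prod with hw
    have hmem : α ∈ LinearMap.range (w - 1) := by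
      rw [hw, h.range_eq l hl, LinearMap.BilinForm.mem_orthogonal_iff]
      intro y hy
      rw [LinearMap.mem_ker, LinearMap.sub_apply, sub_eq_zero, Module.End.one_apply] at hy
      exact hα' y hy
    obtain ⟨v, hv⟩ := hmem
    rw [LinearMap.sub_apply, Module.End.one_apply, sub_eq_iff_eq_add] at hv
    have hfixv : (reflV B α * w) v = v := by
      have h1 := h.prod_isom l hl v v
      rw [← hw, hv] at h1
      simp only [map_add, LinearMap.add_apply, h.symm α v] at h1
      rw [Module.End.mul_apply, hv, map_add, reflV_self a0, reflV_apply,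
        show 2 * B v α = - B α α by linarith, neg_div, div_self a0]
      module
    have hlt : LinearMap.ker (w - 1) < LinearMap.ker (reflV B α * w - 1) := by
      apply lt_of_le_of_ne
      · intro y hy
        rw [LinearMap.mem_ker, LinearMap.sub_apply, sub_eq_zero, Module.End.one_apply] at hy ⊢
        rw [Module.End.mul_apply, hy, reflV_apply, hα' y hy]
        simp
      · intro he
        have : v ∈ LinearMap.ker (w - 1) := by
          rw [he, LinearMap.mem_ker, LinearMap.sub_apply, hfixv]; simp
        rw [LinearMap.mem_ker, LinearMap.sub_apply, sub_eq_zero, Module.End.one_apply, hv] at this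
        exact h.ne_zero α hα (by simpa using this)
    have hfr := Submodule.finrank_lt_finrank_of_lt hlt
    obtain ⟨l', h1, h2, h3⟩ := ih (α :: l) (by
        intro a ha
        rcases List.mem_cons.mp ha with rfl | ha
        · exact hα
        · exact hl a ha) (by
        rw [List.map_cons, List.prod_cons, ← hw]
        omega)
    refine ⟨α :: l', ?_, ?_, by simpa using h3⟩
    · intro a ha
      rcases List.mem_cons.mp ha with rfl | ha
      · exact hα
      · exact h1 a ha
    · rw [List.map_cons, List.prod_cons, h2, List.map_cons, List.prod_cons, ← mul_assoc,
        reflV_mul_self a0, one_mul]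

lemma prod_fix (l : List V) (x : V) (hx : ∀ a ∈ l, B x a = 0) :
    (l.map (reflV B)).prod x = x := by
  induction l with
  | nil => simp
  | cons a l ih =>
    rw [List.map_cons, List.prod_cons, Module.End.mul_apply, ih fun b hb => hx b (by simp [hb]),
      reflV_apply, hx a (by simp)]
    simp

lemma finrank_list_le (l : List V) : Module.finrank ℚ (span ℚ {α | α ∈ l}) ≤ l.length := by
  classical
  have h1 := finrank_span_finset_le_card (R := ℚ) l.toFinset
  have h2 : ((l.toFinset : Finset V) : Set V) = {α | α ∈ l} := by ext; simp
  rw [h2] at h1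
  exact h1.trans l.toFinset_card_le

end helpers

/-- The ℚ-span of the roots of a reduced presentation of `w` equals the `B`-orthogonal
complement of the fixed space `ker (w - 1)`; in particular
`l(w) = n - dim ker (w - 1)`. -/
theorem stmt2 {V : Type} [AddCommGroup V] [Module ℚ V] [FiniteDimensional ℚ V] [Nontrivial V]
    (B : V →ₗ[ℚ] V →ₗ[ℚ] ℚ) (Φ : Set V) (h : IsPNRootLattice B Φ)
    (n : ℕ) (hn : Module.finrank ℚ V = n)
    (w : Module.End ℚ V) (l : List V) (hl : IsPres B Φ w l)
    (hred : l.length = len B Φ w) :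
    span ℚ {α | α ∈ l} = LinearMap.BilinForm.orthogonal B (LinearMap.ker (w - 1)) ∧
    len B Φ w = n - Module.finrank ℚ (LinearMap.ker (w - 1)) := by
  obtain ⟨hlΦ, hw⟩ := hl
  have hker : Module.finrank ℚ (LinearMap.ker (w - 1)) ≤ n := hn ▸ Submodule.finrank_le _
  have hle : LinearMap.BilinForm.orthogonal B (LinearMap.ker (w - 1)) ≤ span ℚ {α | α ∈ l} := by
    rw [← LinearMap.BilinForm.orthogonal_orthogonal h.nondeg h.isRefl (span ℚ {α | α ∈ l})]
    apply LinearMap.BilinForm.orthogonal_le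
    intro x hx
    rw [LinearMap.BilinForm.mem_orthogonal_iff] at hx
    rw [LinearMap.mem_ker, LinearMap.sub_apply, sub_eq_zero, Module.End.one_apply, ← hw]
    exact prod_fix l x fun a ha => by
      rw [h.symm]
      exact hx a (subset_span ha)
  have hfo := LinearMap.BilinForm.finrank_orthogonal h.nondeg (LinearMap.ker (w - 1))
  have h1 := finrank_list_le l
  have h2 := Submodule.finrank_mono hle
  obtain ⟨l', hl1, hl2, hl3⟩ := h.upper (n - Module.finrank ℚ (LinearMap.ker (w - 1))) l hlΦ (by
    rw [hw]; omega)
  have h3 : len B Φ w ≤ l'.length := Nat.sInf_le ⟨l', ⟨hl1, hl2.trans hw⟩, rfl⟩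
  rw [hn] at hfo
  refine ⟨(Submodule.eq_of_le_of_finrank_le hle (by omega)).symm, by omega⟩
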